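/- Let d ≥ 1, α > 0, and let ρ and μ be probability measures on ℝᵈ with finite first moments, with b(μ) = 0. Then there exists a sequence (ρ_n) of compactly supported probability measures on ℝᵈ converging weakly (narrowly) to ρ such that F_μ(ρ_n) → F_μ(ρ). -/

import Mathlib

open MeasureTheory ENNReal
open scoped RealInnerProductSpace

noncomputable section

/-- Euclidean space `ℝᵈ`. -/
abbrev Ed (d : ℕ) := EuclideanSpace ℝ (Fin d)

/-- The positive part of an extended real number, as an element of `ℝ≥0∞`. -/
noncomputable def EReal.posPart (a : EReal) : ℝ≥0∞ :=
  if a = ⊤ then ⊤ else ENNReal.ofReal a.toReal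

/-- Signed integral (with values in `EReal`) of a real-valued function. -/
noncomputable def sInt {α : Type*} [MeasurableSpace α] (ν : Measure α) (g : α → ℝ) : EReal :=
  ((∫⁻ x, ENNReal.ofReal (g x) ∂ν : ℝ≥0∞) : EReal) -
    ((∫⁻ x, ENNReal.ofReal (-(g x)) ∂ν : ℝ≥0∞) : EReal)

/-- Signed integral (with values in `EReal`) of an `EReal`-valued function. -/
noncomputable def eInt {α : Type*} [MeasurableSpace α] (ν : Measure α) (f : α → EReal) : EReal :=
  ((∫⁻ x, (f x).posPart ∂ν : ℝ≥0∞) : EReal) - ((∫⁻ x, (-(f x)).posPart ∂ν : ℝ≥0∞) : EReal)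

/-- The set of couplings (transport plans) between two measures on `ℝᵈ`. -/
def couplings {d : ℕ} (ρ μ : Measure (Ed d)) : Set (Measure (Ed d × Ed d)) :=
  {γ | IsProbabilityMeasure γ ∧ γ.map Prod.fst = ρ ∧ γ.map Prod.snd = μ}

/-- The maximal correlation functional `T(ρ, μ)`. -/
noncomputable def maxCorr {d : ℕ} (ρ μ : Measure (Ed d)) : EReal :=
  ⨆ γ ∈ couplings ρ μ, sInt γ (fun p => ⟪p.1, p.2⟫)

/-- The entropy `E(ρ)` of a measure with respect to Lebesgue measure. -/
noncomputable def Ent {d : ℕ} (ρ : Measure (Ed d)) : EReal := by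
  classical
  exact if _h : ρ ≪ (volume : Measure (Ed d)) then
    sInt (volume : Measure (Ed d))
      (fun x => (ρ.rnDeriv volume x).toReal * Real.log (ρ.rnDeriv volume x).toReal)
  else ⊤

/-- The second moment of a measure, with values in `ℝ≥0∞`. -/
noncomputable def M2e {d : ℕ} (ρ : Measure (Ed d)) : ℝ≥0∞ :=
  ∫⁻ x, ENNReal.ofReal (‖x‖ ^ 2) ∂ρ

/-- The regularized functional `F_μ(ρ) = E(ρ) + T(ρ, μ) + (α/2) M₂(ρ)`. -/
noncomputable def Ffun {d : ℕ} (α : ℝ) (μ ρ : Measure (Ed d)) : EReal :=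
  Ent ρ + maxCorr ρ μ + ((α / 2 : ℝ) : EReal) * ((M2e ρ : ℝ≥0∞) : EReal)

/-- The `p`-th moment `M_p(ρ) = ∫ ‖x‖^p dρ`. -/
noncomputable def Mp {d : ℕ} (p : ℝ) (ρ : Measure (Ed d)) : ℝ :=
  ∫ x, ‖x‖ ^ p ∂ρ

/-- The barycenter `b(ρ) = ∫ x dρ`. -/
noncomputable def bary {d : ℕ} (ρ : Measure (Ed d)) : Ed d :=
  ∫ x, x ∂ρ

/-- Probability measures on `ℝᵈ` with finite first moment. -/
def P1 (d : ℕ) : Set (Measure (Ed d)) :=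
  {ρ | IsProbabilityMeasure ρ ∧ Integrable (fun x => ‖x‖) ρ}

/-- Probability measures on `ℝᵈ` with finite second moment. -/
def P2 (d : ℕ) : Set (Measure (Ed d)) :=
  {ρ | IsProbabilityMeasure ρ ∧ Integrable (fun x => ‖x‖ ^ 2) ρ}

/-- `ρ` is a minimizer of `F_μ` over probability measures with finite first moment. -/
def IsMinOfF {d : ℕ} (α : ℝ) (μ ρ : Measure (Ed d)) : Prop :=
  ρ ∈ P1 d ∧ ∀ σ ∈ P1 d, Ffun α μ ρ ≤ Ffun α μ σ

/-- The 2-Wasserstein distance between two measures on `ℝᵈ`. -/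
noncomputable def W2 {d : ℕ} (ρ μ : Measure (Ed d)) : ℝ :=
  Real.sqrt ((⨅ γ ∈ couplings ρ μ, ∫⁻ p, ENNReal.ofReal (‖p.1 - p.2‖ ^ 2) ∂γ).toReal)

/-- Convexity of an `EReal`-valued function on `ℝᵈ`. -/
def EConvexOn {d : ℕ} (u : Ed d → EReal) : Prop :=
  ∀ x y : Ed d, ∀ s t : ℝ, 0 ≤ s → 0 ≤ t → s + t = 1 →
    u (s • x + t • y) ≤ (s : EReal) * u x + (t : EReal) * u y

/-- The Legendre transform `u*(y) = sup_x (⟨x, y⟩ - u(x))` of an `EReal`-valued function. -/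
noncomputable def legendre {d : ℕ} (u : Ed d → EReal) : Ed d → EReal :=
  fun y => ⨆ x : Ed d, (((⟪x, y⟫ : ℝ) : EReal) - u x)

/-- The Gaussian-regularized density `exp(-u(x) - (α/2)‖x‖²)`, with value `0` where `u = ⊤`. -/
noncomputable def gdens {d : ℕ} (α : ℝ) (u : Ed d → EReal) (x : Ed d) : ℝ≥0∞ :=
  if u x = ⊤ then 0 else ENNReal.ofReal (Real.exp (-(u x).toReal - (α / 2) * ‖x‖ ^ 2))

open Filter Topology ProbabilityTheory

section Integration

variable {α : Type*} [MeasurableSpace α]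

/-- Dominated convergence in `[0, ∞]`, where the limit itself may serve as a dominating function
even if its integral is infinite. -/
theorem tendsto_lintegral_of_le_mul_add {ν : Measure α} {F : ℕ → α → ℝ≥0∞} {f D : α → ℝ≥0∞}
    (C : ℝ≥0∞) (hC : C ≠ ∞) (hF : ∀ n, Measurable (F n)) (hf : Measurable f)
    (hlim : ∀ x, Tendsto (fun n => F n x) atTop (𝓝 (f x)))
    (hle : ∀ n x, F n x ≤ C * f x + D x) (hD : ∫⁻ x, D x ∂ν ≠ ∞) :
    Tendsto (fun n => ∫⁻ x, F n x ∂ν) atTop (𝓝 (∫⁻ x, f x ∂ν)) := by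
  by_cases h : ∫⁻ x, f x ∂ν = ∞
  · have hl : ∫⁻ x, f x ∂ν ≤ liminf (fun n => ∫⁻ x, F n x ∂ν) atTop := by
      refine le_trans (le_of_eq ?_) (lintegral_liminf_le hF)
      exact lintegral_congr fun x => (hlim x).liminf_eq.symm
    rw [h] at hl ⊢
    exact tendsto_of_le_liminf_of_limsup_le hl le_top
  · refine tendsto_lintegral_of_dominated_convergence (fun x => C * f x + D x) hF
      (fun n => ae_of_all _ (hle n)) ?_ (ae_of_all _ hlim)
    rw [lintegral_add_left (hf.const_mul C), lintegral_const_mul C hf]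
    exact ENNReal.add_ne_top.2 ⟨ENNReal.mul_ne_top hC h, hD⟩

theorem tendsto_setLIntegral_of_monotone {ν : Measure α} {B : ℕ → Set α}
    (hB : ∀ n, MeasurableSet (B n)) (hmono : Monotone B) (hU : ⋃ n, B n = Set.univ)
    {f : α → ℝ≥0∞} (hf : Measurable f) :
    Tendsto (fun n => ∫⁻ x in B n, f x ∂ν) atTop (𝓝 (∫⁻ x, f x ∂ν)) := by
  simp_rw [← lintegral_indicator (hB _)]
  refine lintegral_tendsto_of_tendsto_of_monotone
    (fun n => (hf.indicator (hB n)).aemeasurable) (ae_of_all _ fun x => ?_) (ae_of_all _ fun x => ?_)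
  · exact fun m n h => Set.indicator_le_indicator_of_subset (hmono h) (fun _ => zero_le) x
  · obtain ⟨N, hN⟩ := Set.mem_iUnion.1 (hU ▸ Set.mem_univ x)
    refine tendsto_const_nhds.congr' ?_
    filter_upwards [eventually_ge_atTop N] with n hn
    rw [Set.indicator_of_mem (hmono hn hN)]

theorem sInt_eq_coe_integral {ν : Measure α} {g : α → ℝ} (hg : Integrable g ν) :
    sInt ν g = ((∫ x, g x ∂ν : ℝ) : EReal) := by
  have h1 : ∫⁻ x, ENNReal.ofReal (g x) ∂ν ≠ ∞ := hg.lintegral_lt_top.ne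
  have h2 : ∫⁻ x, ENNReal.ofReal (-(g x)) ∂ν ≠ ∞ := hg.neg.lintegral_lt_top.ne
  rw [integral_eq_lintegral_pos_part_sub_lintegral_neg_part hg, sInt, EReal.coe_sub,
    EReal.coe_ennreal_toReal h1, EReal.coe_ennreal_toReal h2]

theorem tendsto_coe_ennreal_sub_coe_ennreal {ι : Type*} {l : Filter ι} {P N : ι → ℝ≥0∞}
    {p q : ℝ≥0∞} (hP : Tendsto P l (𝓝 p)) (hN : Tendsto N l (𝓝 q)) (hq : q ≠ ∞) :
    Tendsto (fun n => (P n : EReal) - (N n : EReal)) l (𝓝 ((p : EReal) - (q : EReal))) := by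
  have h1 := (continuous_coe_ennreal_ereal.tendsto p).comp hP
  have h2 := (continuous_neg.tendsto _).comp ((continuous_coe_ennreal_ereal.tendsto q).comp hN)
  have hc : ContinuousAt (fun a : EReal × EReal => a.1 + a.2) ((p : EReal), -(q : EReal)) := by
    refine EReal.continuousAt_add (Or.inr ?_) (Or.inl (EReal.coe_ennreal_ne_bot p))
    simpa [EReal.neg_eq_bot_iff] using hq
  exact hc.tendsto.comp (h1.prodMk_nhds h2)

theorem tendsto_sInt_restrict {ν : Measure α} {B : ℕ → Set α}
    (hB : ∀ n, MeasurableSet (B n)) (hmono : Monotone B) (hU : ⋃ n, B n = Set.univ)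
    {g : α → ℝ} (hg : Measurable g) (hneg : ∫⁻ x, ENNReal.ofReal (-(g x)) ∂ν ≠ ∞) :
    Tendsto (fun n => sInt (ν.restrict (B n)) g) atTop (𝓝 (sInt ν g)) :=
  tendsto_coe_ennreal_sub_coe_ennreal
    (tendsto_setLIntegral_of_monotone hB hmono hU hg.ennreal_ofReal)
    (tendsto_setLIntegral_of_monotone hB hmono hU hg.neg.ennreal_ofReal) hneg

variable {ρ : Measure α} {B : ℕ → Set α}

theorem tendsto_measure_of_iUnion_eq_univ [IsProbabilityMeasure ρ]
    (hmono : Monotone B) (hU : ⋃ n, B n = Set.univ) :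
    Tendsto (fun n => ρ (B n)) atTop (𝓝 1) := by
  simpa [hU, Function.comp_def] using tendsto_measure_iUnion_atTop (μ := ρ) hmono

theorem tendsto_inv_measureReal_of_iUnion_eq_univ [IsProbabilityMeasure ρ]
    (hmono : Monotone B) (hU : ⋃ n, B n = Set.univ) :
    Tendsto (fun n => (ρ.real (B n))⁻¹) atTop (𝓝 1) := by
  have h := (ENNReal.tendsto_toReal ENNReal.one_ne_top).comp
    (tendsto_measure_of_iUnion_eq_univ (ρ := ρ) hmono hU)
  simpa [Measure.real] using h.inv₀ (by simp)

theorem tendsto_lintegral_cond [IsProbabilityMeasure ρ] (hB : ∀ n, MeasurableSet (B n))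
    (hmono : Monotone B) (hU : ⋃ n, B n = Set.univ) {f : α → ℝ≥0∞} (hf : Measurable f) :
    Tendsto (fun n => ∫⁻ x, f x ∂(ρ[|B n])) atTop (𝓝 (∫⁻ x, f x ∂ρ)) := by
  simp_rw [ProbabilityTheory.cond, lintegral_smul_measure, smul_eq_mul]
  have h1 := tendsto_inv_iff.2 (tendsto_measure_of_iUnion_eq_univ (ρ := ρ) hmono hU)
  have h := ENNReal.Tendsto.mul h1 (by simp)
    (tendsto_setLIntegral_of_monotone (ν := ρ) hB hmono hU hf) (by simp)
  simpa using h

theorem tendsto_integral_cond [IsProbabilityMeasure ρ] (hB : ∀ n, MeasurableSet (B n))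
    (hmono : Monotone B) (hU : ⋃ n, B n = Set.univ) {g : α → ℝ} (hg : Integrable g ρ) :
    Tendsto (fun n => ∫ x, g x ∂(ρ[|B n])) atTop (𝓝 (∫ x, g x ∂ρ)) := by
  have h := (tendsto_inv_measureReal_of_iUnion_eq_univ (ρ := ρ) hmono hU).mul
    (tendsto_setIntegral_of_monotone hB hmono (hg.integrableOn (s := ⋃ n, B n)))
  rw [hU, Measure.restrict_univ, one_mul] at h
  refine h.congr fun n => ?_
  simp [ProbabilityTheory.cond, integral_smul_measure, Measure.real]

end Integration

section Entropy

variable {d : ℕ}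

theorem neg_mul_log_le {t : ℝ} (ht : 0 ≤ t) (s : ℝ) :
    -(t * Real.log t) ≤ t * s + Real.exp (-s) := by
  rcases ht.eq_or_lt with rfl | ht
  · simpa using (Real.exp_pos _).le
  · have h := Real.log_le_sub_one_of_pos (div_pos (Real.exp_pos (-s)) ht)
    rw [Real.log_div (Real.exp_pos _).ne' ht.ne', Real.log_exp] at h
    have h2 := mul_le_mul_of_nonneg_left h ht.le
    have h3 : t * (Real.exp (-s) / t - 1) = Real.exp (-s) - t := by field_simp
    nlinarith

theorem neg_mul_log_le_norm_mul_add_rpow {E : Type*} [SeminormedAddGroup E] {t r : ℝ} (ht : 0 ≤ t)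
    (hr : 0 ≤ r) (x : E) :
    -(t * Real.log t) ≤ r * (t * ‖x‖) + (1 + ‖x‖) ^ (-r) := by
  have hx : 0 < 1 + ‖x‖ := by positivity
  have h := neg_mul_log_le ht (r * Real.log (1 + ‖x‖))
  have h1 : Real.exp (-(r * Real.log (1 + ‖x‖))) = (1 + ‖x‖) ^ (-r) := by
    rw [Real.rpow_def_of_pos hx]; ring_nf
  have h2 : Real.log (1 + ‖x‖) ≤ ‖x‖ := by
    linarith [Real.log_le_sub_one_of_pos hx]
  rw [h1] at h
  have h3 : t * (r * Real.log (1 + ‖x‖)) ≤ t * (r * ‖x‖) := by gcongr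
  linarith

theorem lintegral_neg_mul_log_rnDeriv_ne_top {ρ : Measure (Ed d)} (hρ : ρ ∈ P1 d) :
    ∫⁻ x, ENNReal.ofReal (-((ρ.rnDeriv volume x).toReal *
      Real.log (ρ.rnDeriv volume x).toReal)) ≠ ∞ := by
  have := hρ.1
  set r : ℝ := (d : ℝ) + 1
  have hr : 0 ≤ r := by positivity
  set φ : Ed d → ℝ := fun x => (ρ.rnDeriv volume x).toReal
  have hφ : ∀ x, 0 ≤ φ x := fun x => ENNReal.toReal_nonneg
  have h1 : Integrable (fun x : Ed d => (1 + ‖x‖) ^ (-r)) volume :=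
    integrable_one_add_norm (by simp [r])
  have h2 : Integrable (fun x => φ x * ‖x‖) volume := by
    have hle : (volume : Measure (Ed d)).withDensity (ρ.rnDeriv volume) ≤ ρ :=
      Measure.withDensity_rnDeriv_le _ _
    have h := hρ.2.mono_measure hle
    rw [integrable_withDensity_iff (Measure.measurable_rnDeriv _ _)
      (Measure.rnDeriv_lt_top _ _)] at h
    simpa [φ, mul_comm] using h
  refine ne_top_of_le_ne_top ((h2.const_mul r).add h1).lintegral_lt_top.ne
    (lintegral_mono fun x => ENNReal.ofReal_le_ofReal ?_)
  exact neg_mul_log_le_norm_mul_add_rpow (hφ x) hr x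

theorem Ent_ne_bot {ρ : Measure (Ed d)} (hρ : ρ ∈ P1 d) : Ent ρ ≠ ⊥ := by
  unfold Ent
  split_ifs with h
  · rw [sInt, sub_eq_add_neg, Ne, EReal.add_eq_bot_iff]
    simpa [EReal.neg_eq_bot_iff] using lintegral_neg_mul_log_rnDeriv_ne_top hρ
  · simp

theorem rnDeriv_cond_toReal {α : Type*} [MeasurableSpace α] (ρ ν : Measure α)
    [IsFiniteMeasure ρ] [SigmaFinite ν] {s : Set α} (hs : MeasurableSet s) (h0 : ρ s ≠ 0) :
    (fun x => ((ρ[|s]).rnDeriv ν x).toReal) =ᵐ[ν]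
      s.indicator (fun x => (ρ.real s)⁻¹ * (ρ.rnDeriv ν x).toReal) := by
  filter_upwards [Measure.rnDeriv_smul_left_of_ne_top (ρ.restrict s) ν (ENNReal.inv_ne_top.2 h0),
    Measure.rnDeriv_restrict ρ ν hs] with x h1 h2
  rw [ProbabilityTheory.cond, h1, Pi.smul_apply, h2]
  by_cases hx : x ∈ s <;> simp [hx, Measure.real]

theorem mul_log_mul_le {c t : ℝ} (h1 : 1 ≤ c) (h2 : c ≤ 2) (ht : 0 ≤ t) :
    c * t * Real.log (c * t) ≤ 2 * max (t * Real.log t) 0 + 2 * Real.log 2 * t := by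
  rcases ht.eq_or_lt with rfl | ht
  · simp
  · rw [Real.log_mul (by positivity) ht.ne']
    have hc : Real.log c ≤ Real.log 2 := Real.log_le_log (by linarith) h2
    have hc0 : 0 ≤ Real.log c := Real.log_nonneg h1
    have a1 : c * (t * Real.log t) ≤ 2 * max (t * Real.log t) 0 :=
      (mul_le_mul_of_nonneg_left (le_max_left _ 0) (by linarith)).trans
        (mul_le_mul_of_nonneg_right h2 (le_max_right _ _))
    have a2 : c * Real.log c ≤ 2 * Real.log 2 := mul_le_mul h2 hc hc0 (by norm_num)
    have a3 := mul_le_mul_of_nonneg_right a2 ht.le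
    linarith

theorem neg_mul_log_mul_le {c t : ℝ} (h1 : 1 ≤ c) (h2 : c ≤ 2) (ht : 0 ≤ t) :
    -(c * t * Real.log (c * t)) ≤ 2 * max (-(t * Real.log t)) 0 := by
  rcases ht.eq_or_lt with rfl | ht
  · simp
  · rw [Real.log_mul (by positivity) ht.ne']
    have hc0 : 0 ≤ Real.log c := Real.log_nonneg h1
    have a1 : c * (-(t * Real.log t)) ≤ 2 * max (-(t * Real.log t)) 0 :=
      (mul_le_mul_of_nonneg_left (le_max_left _ 0) (by linarith)).trans
        (mul_le_mul_of_nonneg_right h2 (le_max_right _ _))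
    have a2 : 0 ≤ c * t * Real.log c := by positivity
    linarith

theorem tendsto_Ent_cond {ρ : Measure (Ed d)} (hρ : ρ ∈ P1 d) {B : ℕ → Set (Ed d)}
    (hB : ∀ n, MeasurableSet (B n)) (hmono : Monotone B) (hU : ⋃ n, B n = Set.univ)
    (hhalf : ∀ n, 1 / 2 ≤ ρ.real (B n)) :
    Tendsto (fun n => Ent (ρ[|B n])) atTop (𝓝 (Ent ρ)) := by
  have := hρ.1
  have h0 : ∀ n, ρ (B n) ≠ 0 := fun n h => by
    have := hhalf n
    norm_num [Measure.real, h] at this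
  by_cases hac : ρ ≪ (volume : Measure (Ed d))
  · have hac' : ∀ n, ρ[|B n] ≪ (volume : Measure (Ed d)) := fun n =>
      cond_absolutelyContinuous.trans hac
    simp only [Ent, hac, hac', dif_pos]
    set φ : Ed d → ℝ := fun x => (ρ.rnDeriv volume x).toReal
    have hφ : ∀ x, 0 ≤ φ x := fun x => ENNReal.toReal_nonneg
    have hφm : Measurable φ := (Measure.measurable_rnDeriv _ _).ennreal_toReal
    have hφi : Integrable φ volume := Measure.integrable_toReal_rnDeriv
    set c : ℕ → ℝ := fun n => (ρ.real (B n))⁻¹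
    have hc1 : ∀ n, 1 ≤ c n := fun n =>
      (one_le_inv₀ (by linarith [hhalf n])).2 measureReal_le_one
    have hc2 : ∀ n, c n ≤ 2 := fun n => by
      simpa using inv_anti₀ (by norm_num) (hhalf n)
    set G : ℕ → Ed d → ℝ := fun n => (B n).indicator (fun x => c n * φ x)
    have hGm : ∀ n, Measurable (G n) := fun n => (hφm.const_mul _).indicator (hB n)
    have hG : ∀ n, sInt volume (fun x => ((ρ[|B n]).rnDeriv volume x).toReal *
        Real.log ((ρ[|B n]).rnDeriv volume x).toReal) =
        sInt volume (fun x => G n x * Real.log (G n x)) := fun n => by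
      have hae := rnDeriv_cond_toReal ρ volume (hB n) (h0 n)
      unfold sInt
      congr 2
      · refine lintegral_congr_ae ?_
        filter_upwards [hae] with x hx
        rw [hx]
      · refine lintegral_congr_ae ?_
        filter_upwards [hae] with x hx
        rw [hx]
    simp_rw [hG]
    have hlim : ∀ x, Tendsto (fun n => G n x * Real.log (G n x)) atTop
        (𝓝 (φ x * Real.log (φ x))) := fun x => by
      refine (Real.continuous_mul_log.tendsto _).comp ?_
      have h1 : Tendsto (fun n => c n * φ x) atTop (𝓝 (φ x)) := by
        simpa using (tendsto_inv_measureReal_of_iUnion_eq_univ (ρ := ρ) hmono hU).mul_const (φ x)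
      refine h1.congr' ?_
      obtain ⟨N, hN⟩ := Set.mem_iUnion.1 (hU ▸ Set.mem_univ x)
      filter_upwards [eventually_ge_atTop N] with n hn
      simp [G, hmono hn hN]
    have hmm : ∀ {g : Ed d → ℝ}, Measurable g → Measurable (fun x => g x * Real.log (g x)) :=
      fun hg => hg.mul hg.log
    refine tendsto_coe_ennreal_sub_coe_ennreal ?_ ?_ (lintegral_neg_mul_log_rnDeriv_ne_top hρ)
    · refine tendsto_lintegral_of_le_mul_add
        (D := fun x => ENNReal.ofReal (2 * Real.log 2 * φ x)) 2 (by simp)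
        (fun n => (hmm (hGm n)).ennreal_ofReal) (hmm hφm).ennreal_ofReal
        (fun x => ENNReal.tendsto_ofReal (hlim x)) (fun n x => ?_)
        (hφi.const_mul _).lintegral_lt_top.ne
      by_cases hx : x ∈ B n
      · have h := ENNReal.ofReal_le_ofReal (mul_log_mul_le (hc1 n) (hc2 n) (hφ x))
        rw [ENNReal.ofReal_add (by positivity) (mul_nonneg (by positivity) (hφ x)),
          ENNReal.ofReal_mul (p := 2) (by norm_num), ENNReal.ofReal_max] at h
        simpa [G, hx, φ] using h
      · simp [G, hx]
    · refine tendsto_lintegral_of_le_mul_add (D := fun _ => 0) 2 (by simp)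
        (fun n => (hmm (hGm n)).neg.ennreal_ofReal) (hmm hφm).neg.ennreal_ofReal
        (fun x => ENNReal.tendsto_ofReal (hlim x).neg) (fun n x => ?_) (by simp)
      by_cases hx : x ∈ B n
      · have h := ENNReal.ofReal_le_ofReal (neg_mul_log_mul_le (hc1 n) (hc2 n) (hφ x))
        rw [ENNReal.ofReal_mul (by norm_num), ENNReal.ofReal_max] at h
        simpa [G, hx] using h
      · simp [G, hx]
  · have hev : ∀ᶠ n in atTop, ¬ (ρ[|B n] ≪ (volume : Measure (Ed d))) := by
      rw [Measure.AbsolutelyContinuous] at hac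
      push Not at hac
      obtain ⟨A, hA, hρA⟩ := hac
      have hm : Monotone fun n => B n ∩ A := fun m n h => Set.inter_subset_inter_left _ (hmono h)
      have ht := tendsto_measure_iUnion_atTop (μ := ρ) hm
      rw [← Set.iUnion_inter, hU, Set.univ_inter] at ht
      filter_upwards [ht.eventually_ne hρA] with n hn hcac
      have h := hcac hA
      rw [cond_apply (hB n), mul_eq_zero, ENNReal.inv_eq_zero] at h
      exact h.elim (measure_ne_top _ _) hn
    simp only [Ent, hac, dif_neg, not_false_eq_true]
    refine tendsto_const_nhds.congr' ?_
    filter_upwards [hev] with n hn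
    simp [hn]

end Entropy

section MaxCorr

variable {d : ℕ}

theorem measurable_inner_fst_snd : Measurable (fun p : Ed d × Ed d => ⟪p.1, p.2⟫) :=
  measurable_fst.inner measurable_snd

theorem integrable_inner_of_ae_norm_fst_le {γ : Measure (Ed d × Ed d)} {R : ℝ}
    (h1 : ∀ᵐ p ∂γ, ‖p.1‖ ≤ R) (h2 : Integrable (fun p => ‖p.2‖) γ) :
    Integrable (fun p => ⟪p.1, p.2⟫) γ := by
  refine (h2.const_mul R).mono' measurable_inner_fst_snd.aestronglyMeasurable ?_
  filter_upwards [h1] with p hp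
  exact (norm_inner_le_norm _ _).trans (mul_le_mul_of_nonneg_right hp (norm_nonneg _))

theorem integrable_id_of_norm {σ : Measure (Ed d)} (h : Integrable (fun x => ‖x‖) σ) :
    Integrable (fun x => x) σ :=
  (integrable_norm_iff aestronglyMeasurable_id).1 h

theorem integrable_inner_prod {σ μ : Measure (Ed d)} [SFinite σ] [SFinite μ]
    (hσ : Integrable (fun x => ‖x‖) σ) (hμ : Integrable (fun x => ‖x‖) μ) :
    Integrable (fun p : Ed d × Ed d => ⟪p.1, p.2⟫) (σ.prod μ) :=
  (hσ.mul_prod hμ).mono' measurable_inner_fst_snd.aestronglyMeasurable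
    (ae_of_all _ fun _ => norm_inner_le_norm _ _)

theorem integral_inner_prod {σ μ : Measure (Ed d)} [SFinite σ] [SFinite μ]
    (hσ : Integrable (fun x => ‖x‖) σ) (hμ : Integrable (fun x => ‖x‖) μ) :
    ∫ p, ⟪p.1, p.2⟫ ∂(σ.prod μ) = ⟪bary σ, bary μ⟫ := by
  rw [integral_prod _ (integrable_inner_prod hσ hμ)]
  simp_rw [integral_inner (integrable_id_of_norm hμ)]
  simp_rw [real_inner_comm (∫ y, y ∂μ)]
  rw [integral_inner (integrable_id_of_norm hσ), real_inner_comm]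
  rfl

theorem maxCorr_nonneg {σ μ : Measure (Ed d)} (hσ : σ ∈ P1 d) (hμ : μ ∈ P1 d)
    (hbμ : bary μ = 0) : 0 ≤ maxCorr σ μ := by
  have := hσ.1
  have := hμ.1
  refine le_iSup₂_of_le (σ.prod μ) ⟨inferInstance, by simp, by simp⟩ ?_
  rw [sInt_eq_coe_integral (integrable_inner_prod hσ.2 hμ.2), integral_inner_prod hσ.2 hμ.2, hbμ]
  simp

theorem integrable_norm_snd_of_mem_couplings {σ μ : Measure (Ed d)} (hμ : μ ∈ P1 d)
    {γ : Measure (Ed d × Ed d)} (hγ : γ ∈ couplings σ μ) : Integrable (fun p => ‖p.2‖) γ := by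
  have h := hμ.2
  rw [← hγ.2.2] at h
  exact h.comp_measurable measurable_snd

theorem ae_norm_fst_le_of_mem_couplings_cond {ρ μ : Measure (Ed d)} {s : Set (Ed d)}
    (hs : MeasurableSet s) {R : ℝ} (hR : ∀ x ∈ s, ‖x‖ ≤ R)
    {γ : Measure (Ed d × Ed d)} (hγ : γ ∈ couplings (ρ[|s]) μ) : ∀ᵐ p ∂γ, ‖p.1‖ ≤ R := by
  have h : ∀ᵐ x ∂(ρ[|s]), ‖x‖ ≤ R :=
    Measure.ae_smul_measure ((ae_restrict_mem hs).mono hR) _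
  rw [← hγ.2.1] at h
  exact ae_of_ae_map measurable_fst.aemeasurable h

theorem smul_cond {ρ : Measure (Ed d)} [IsFiniteMeasure ρ] {s : Set (Ed d)} (h0 : ρ s ≠ 0) :
    ρ s • ρ[|s] = ρ.restrict s := by
  rw [ProbabilityTheory.cond, smul_smul, ENNReal.mul_inv_cancel h0 (measure_ne_top _ _), one_smul]

/-- A coupling of the truncated measure extends to a coupling of the full measure by the product
coupling on the complement, which does not contribute since `μ` is centered. -/
theorem maxCorr_cond_le {ρ μ : Measure (Ed d)} (hρ : ρ ∈ P1 d) (hμ : μ ∈ P1 d)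
    (hbμ : bary μ = 0) {s : Set (Ed d)} (hs : MeasurableSet s) (h0 : ρ s ≠ 0) {R : ℝ}
    (hR : ∀ x ∈ s, ‖x‖ ≤ R) :
    maxCorr (ρ[|s]) μ ≤ (((ρ.real s)⁻¹ : ℝ) : EReal) * maxCorr ρ μ := by
  have := hρ.1
  have := hμ.1
  refine iSup₂_le fun γ hγ => ?_
  have := hγ.1
  have hZ : 0 < ρ.real s := ENNReal.toReal_pos h0 (measure_ne_top _ _)
  have hk := integrable_inner_of_ae_norm_fst_le (ae_norm_fst_le_of_mem_couplings_cond hs hR hγ)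
    (integrable_norm_snd_of_mem_couplings hμ hγ)
  have hk1 : Integrable (fun p => ⟪p.1, p.2⟫) (ρ s • γ) := hk.smul_measure (measure_ne_top _ _)
  have hr : Integrable (fun x => ‖x‖) (ρ.restrict sᶜ) := hρ.2.restrict
  have hk2 := integrable_inner_prod hr hμ.2
  set γ' := ρ s • γ + (ρ.restrict sᶜ).prod μ with hγ'
  have h1 : γ'.map Prod.fst = ρ := by
    rw [hγ', Measure.map_add _ _ measurable_fst, Measure.map_smul, hγ.2.1, smul_cond h0,
      Measure.map_fst_prod, measure_univ, one_smul, Measure.restrict_add_restrict_compl hs]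
  have h2 : γ'.map Prod.snd = μ := by
    rw [hγ', Measure.map_add _ _ measurable_snd, Measure.map_smul, hγ.2.2, Measure.map_snd_prod,
      Measure.restrict_apply_univ, ← add_smul, measure_add_measure_compl hs, measure_univ, one_smul]
  have hp : IsProbabilityMeasure γ' := by
    have : IsProbabilityMeasure (γ'.map Prod.fst) := h1 ▸ hρ.1
    exact Measure.isProbabilityMeasure_of_map Prod.fst
  have hle : sInt γ' (fun p => ⟪p.1, p.2⟫) ≤ maxCorr ρ μ :=
    le_iSup₂_of_le γ' ⟨hp, h1, h2⟩ le_rfl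
  rw [sInt_eq_coe_integral (hk1.add_measure hk2), integral_add_measure hk1 hk2,
    integral_inner_prod hr hμ.2, hbμ, inner_zero_right, add_zero, integral_smul_measure] at hle
  rw [sInt_eq_coe_integral hk]
  have h := mul_le_mul_of_nonneg_left hle
    (show (0 : EReal) ≤ (((ρ.real s)⁻¹ : ℝ) : EReal) by exact_mod_cast (inv_pos.2 hZ).le)
  rw [← EReal.coe_mul] at h
  convert h using 2
  change _ = (ρ.real s)⁻¹ * (ρ.real s * _)
  rw [inv_mul_cancel_left₀ hZ.ne']

/-- A coupling of the full measure, restricted to a bounded set, completes to a coupling of the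
truncated measure by a product coupling. -/
theorem coe_integral_add_inner_le_maxCorr_cond {ρ μ : Measure (Ed d)} (hρ : ρ ∈ P1 d)
    (hμ : μ ∈ P1 d) {γ : Measure (Ed d × Ed d)} (hγ : γ ∈ couplings ρ μ) {s : Set (Ed d)}
    (hs : MeasurableSet s) (h0 : ρ s ≠ 0) {R : ℝ} (hR : ∀ x ∈ s, ‖x‖ ≤ R) :
    sInt (γ.restrict (Prod.fst ⁻¹' s)) (fun p => ⟪p.1, p.2⟫) +
      ((⟪bary (ρ[|s]), ∫ p in (Prod.fst ⁻¹' s)ᶜ, p.2 ∂γ⟫ : ℝ) : EReal) ≤ maxCorr (ρ[|s]) μ := by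
  have := hρ.1
  have := hγ.1
  have := cond_isProbabilityMeasure h0
  have hS : MeasurableSet (Prod.fst ⁻¹' s : Set (Ed d × Ed d)) := measurable_fst hs
  have hsnd := integrable_norm_snd_of_mem_couplings hμ hγ
  set S : Set (Ed d × Ed d) := Prod.fst ⁻¹' s
  set η := (γ.restrict Sᶜ).map Prod.snd with hη
  have hηi : Integrable (fun y => ‖y‖) η :=
    (integrable_map_measure continuous_norm.aestronglyMeasurable measurable_snd.aemeasurable).2
      hsnd.restrict
  have hρi : Integrable (fun x => ‖x‖) (ρ[|s]) :=
    hρ.2.restrict.smul_measure (ENNReal.inv_ne_top.2 h0)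
  have hbη : bary η = ∫ p in Sᶜ, p.2 ∂γ :=
    integral_map measurable_snd.aemeasurable aestronglyMeasurable_id
  have hk1 : Integrable (fun p => ⟪p.1, p.2⟫) (γ.restrict S) :=
    integrable_inner_of_ae_norm_fst_le ((ae_restrict_mem hS).mono fun p hp => hR _ hp)
      hsnd.restrict
  have hk2 := integrable_inner_prod hρi hηi
  have hSγ : ∀ t : Set (Ed d), MeasurableSet t → γ (Prod.fst ⁻¹' t) = ρ t := fun t ht => by
    rw [← hγ.2.1, Measure.map_apply measurable_fst ht]
  have hηu : η Set.univ = ρ sᶜ := by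
    rw [hη, Measure.map_apply measurable_snd MeasurableSet.univ, Set.preimage_univ,
      Measure.restrict_apply_univ, ← hSγ _ hs.compl]
    rfl
  set γ' := γ.restrict S + (ρ[|s]).prod η with hγ'
  have h1 : γ'.map Prod.fst = ρ[|s] := by
    rw [hγ', Measure.map_add _ _ measurable_fst, ← Measure.restrict_map measurable_fst hs, hγ.2.1,
      Measure.map_fst_prod, hηu, ← smul_cond h0, ← add_smul, measure_add_measure_compl hs,
      measure_univ, one_smul]
  have h2 : γ'.map Prod.snd = μ := by
    rw [hγ', Measure.map_add _ _ measurable_snd, Measure.map_snd_prod, measure_univ, one_smul, hη,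
      ← Measure.map_add _ _ measurable_snd, Measure.restrict_add_restrict_compl hS, hγ.2.2]
  have hp : IsProbabilityMeasure γ' := by
    have : IsProbabilityMeasure (γ'.map Prod.fst) := by rw [h1]; infer_instance
    exact Measure.isProbabilityMeasure_of_map Prod.fst
  refine le_iSup₂_of_le γ' ⟨hp, h1, h2⟩ ?_
  rw [sInt_eq_coe_integral hk1, sInt_eq_coe_integral (hk1.add_measure hk2),
    integral_add_measure hk1 hk2, integral_inner_prod hρi hηi, hbη, EReal.coe_add]

variable {ρ μ : Measure (Ed d)} {B : ℕ → Set (Ed d)}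

theorem tendsto_bary_cond (hρ : ρ ∈ P1 d) (hB : ∀ n, MeasurableSet (B n))
    (hmono : Monotone B) (hU : ⋃ n, B n = Set.univ) :
    Tendsto (fun n => bary (ρ[|B n])) atTop (𝓝 (bary ρ)) := by
  have := hρ.1
  have h := (tendsto_inv_measureReal_of_iUnion_eq_univ (ρ := ρ) hmono hU).smul
    (tendsto_setIntegral_of_monotone hB hmono
      ((integrable_id_of_norm hρ.2).integrableOn (s := ⋃ n, B n)))
  rw [hU, Measure.restrict_univ, one_smul] at h
  refine h.congr fun n => ?_
  simp [bary, ProbabilityTheory.cond, integral_smul_measure, Measure.real]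

theorem eventually_lt_maxCorr_cond (hρ : ρ ∈ P1 d) (hμ : μ ∈ P1 d)
    (hB : ∀ n, MeasurableSet (B n)) (hmono : Monotone B) (hU : ⋃ n, B n = Set.univ)
    (h0 : ∀ n, ρ (B n) ≠ 0) (hbdd : ∀ n, ∃ R : ℝ, ∀ x ∈ B n, ‖x‖ ≤ R)
    {a : EReal} (ha : a < maxCorr ρ μ) : ∀ᶠ n in atTop, a < maxCorr (ρ[|B n]) μ := by
  obtain ⟨γ, hγ, haγ⟩ := by simpa only [maxCorr, lt_iSup_iff, exists_prop] using ha
  have := hγ.1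
  set S : ℕ → Set (Ed d × Ed d) := fun n => Prod.fst ⁻¹' B n
  have hS : ∀ n, MeasurableSet (S n) := fun n => measurable_fst (hB n)
  have hSm : Monotone S := fun m n h => Set.preimage_mono (hmono h)
  have hSU : ⋃ n, S n = Set.univ := by
    simp only [S, ← Set.preimage_iUnion, hU, Set.preimage_univ]
  have hneg : ∫⁻ p, ENNReal.ofReal (-⟪p.1, p.2⟫) ∂γ ≠ ∞ := by
    intro h
    rw [sInt, h] at haγ
    simp at haγ
  have t1 := tendsto_sInt_restrict hS hSm hSU measurable_inner_fst_snd hneg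
  have hi : Integrable (fun p : Ed d × Ed d => p.2) γ :=
    (integrable_norm_iff measurable_snd.aestronglyMeasurable).1
      (integrable_norm_snd_of_mem_couplings hμ hγ)
  have t2 : Tendsto (fun n => ∫ p in (S n)ᶜ, p.2 ∂γ) atTop (𝓝 0) := by
    have h := tendsto_setIntegral_of_antitone (μ := γ) (f := fun p : Ed d × Ed d => p.2)
      (fun n => (hS n).compl) (fun m n h => Set.compl_subset_compl.2 (hSm h))
      ⟨0, hi.integrableOn⟩
    rwa [← Set.compl_iUnion, hSU, Set.compl_univ, Measure.restrict_empty,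
      integral_zero_measure] at h
  have t3 := (tendsto_bary_cond hρ hB hmono hU).inner (𝕜 := ℝ) t2
  rw [inner_zero_right] at t3
  have t4 := (continuous_coe_real_ereal.tendsto _).comp t3
  have hc := EReal.continuousAt_add (p := (sInt γ (fun p => ⟪p.1, p.2⟫), ((0 : ℝ) : EReal)))
    (Or.inr (EReal.coe_ne_bot 0)) (Or.inr (EReal.coe_ne_top 0))
  have t5 := hc.tendsto.comp (t1.prodMk_nhds t4)
  simp only [EReal.coe_zero, add_zero] at t5
  filter_upwards [t5.eventually_const_lt haγ] with n hn
  obtain ⟨R, hR⟩ := hbdd n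
  exact hn.trans_le (coe_integral_add_inner_le_maxCorr_cond hρ hμ hγ (hB n) (h0 n) hR)

theorem eventually_maxCorr_cond_lt (hρ : ρ ∈ P1 d) (hμ : μ ∈ P1 d) (hbμ : bary μ = 0)
    (hB : ∀ n, MeasurableSet (B n)) (hmono : Monotone B) (hU : ⋃ n, B n = Set.univ)
    (h0 : ∀ n, ρ (B n) ≠ 0) (hbdd : ∀ n, ∃ R : ℝ, ∀ x ∈ B n, ‖x‖ ≤ R)
    {a : EReal} (ha : maxCorr ρ μ < a) : ∀ᶠ n in atTop, maxCorr (ρ[|B n]) μ < a := by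
  have := hρ.1
  have hle : ∀ n, maxCorr (ρ[|B n]) μ ≤ (((ρ.real (B n))⁻¹ : ℝ) : EReal) * maxCorr ρ μ := fun n =>
    (hbdd n).elim fun _ hR => maxCorr_cond_le hρ hμ hbμ (hB n) (h0 n) hR
  have hnn := maxCorr_nonneg hρ hμ hbμ
  lift maxCorr ρ μ to ℝ using ⟨ha.ne_top, (EReal.bot_lt_zero.trans_le hnn).ne'⟩ with c
  have h := ((tendsto_inv_measureReal_of_iUnion_eq_univ (ρ := ρ) hmono hU).mul_const c)
  rw [one_mul] at h
  filter_upwards [((continuous_coe_real_ereal.tendsto _).comp h).eventually_lt_const ha] with n hn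
  refine (hle n).trans_lt ?_
  simpa only [Function.comp_apply, EReal.coe_mul] using hn

theorem tendsto_maxCorr_cond (hρ : ρ ∈ P1 d) (hμ : μ ∈ P1 d) (hbμ : bary μ = 0)
    (hB : ∀ n, MeasurableSet (B n)) (hmono : Monotone B) (hU : ⋃ n, B n = Set.univ)
    (h0 : ∀ n, ρ (B n) ≠ 0) (hbdd : ∀ n, ∃ R : ℝ, ∀ x ∈ B n, ‖x‖ ≤ R) :
    Tendsto (fun n => maxCorr (ρ[|B n]) μ) atTop (𝓝 (maxCorr ρ μ)) :=
  tendsto_order.2 ⟨fun _ => eventually_lt_maxCorr_cond hρ hμ hB hmono hU h0 hbdd,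
    fun _ => eventually_maxCorr_cond_lt hρ hμ hbμ hB hmono hU h0 hbdd⟩

end MaxCorr

theorem tendsto_M2e_cond {d : ℕ} {ρ : Measure (Ed d)} [IsProbabilityMeasure ρ]
    {B : ℕ → Set (Ed d)} (hB : ∀ n, MeasurableSet (B n)) (hmono : Monotone B)
    (hU : ⋃ n, B n = Set.univ) : Tendsto (fun n => M2e (ρ[|B n])) atTop (𝓝 (M2e ρ)) :=
  tendsto_lintegral_cond hB hmono hU (measurable_norm.pow_const 2).ennreal_ofReal

theorem tendsto_Ffun_cond {d : ℕ} {α : ℝ} (hα : 0 < α) {ρ μ : Measure (Ed d)} (hρ : ρ ∈ P1 d)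
    (hμ : μ ∈ P1 d) (hbμ : bary μ = 0) {B : ℕ → Set (Ed d)} (hB : ∀ n, MeasurableSet (B n))
    (hmono : Monotone B) (hU : ⋃ n, B n = Set.univ) (hhalf : ∀ n, 1 / 2 ≤ ρ.real (B n))
    (hbdd : ∀ n, ∃ R : ℝ, ∀ x ∈ B n, ‖x‖ ≤ R) :
    Tendsto (fun n => Ffun α μ (ρ[|B n])) atTop (𝓝 (Ffun α μ ρ)) := by
  have := hρ.1
  have h0 : ∀ n, ρ (B n) ≠ 0 := fun n h => by
    have := hhalf n
    norm_num [Measure.real, h] at this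
  have hT : maxCorr ρ μ ≠ ⊥ := (EReal.bot_lt_zero.trans_le (maxCorr_nonneg hρ hμ hbμ)).ne'
  have hE := Ent_ne_bot hρ
  have t1 := tendsto_Ent_cond hρ hB hmono hU hhalf
  have t2 := tendsto_maxCorr_cond hρ hμ hbμ hB hmono hU h0 hbdd
  have hM : ∀ σ : Measure (Ed d), ((α / 2 : ℝ) : EReal) * ((M2e σ : ℝ≥0∞) : EReal) =
      ((ENNReal.ofReal (α / 2) * M2e σ : ℝ≥0∞) : EReal) := fun σ => by
    rw [EReal.coe_ennreal_mul, EReal.coe_ennreal_ofReal, max_eq_left (by positivity)]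
  have t3 := (continuous_coe_ennreal_ereal.tendsto _).comp
    (ENNReal.Tendsto.const_mul (a := ENNReal.ofReal (α / 2)) (tendsto_M2e_cond hB hmono hU (ρ := ρ))
      (Or.inr ENNReal.ofReal_ne_top))
  have t4 := (EReal.continuousAt_add (p := (Ent ρ, maxCorr ρ μ)) (Or.inr hT)
    (Or.inl hE)).tendsto.comp (t1.prodMk_nhds t2)
  have t5 := (EReal.continuousAt_add
    (p := (Ent ρ + maxCorr ρ μ, ((ENNReal.ofReal (α / 2) * M2e ρ : ℝ≥0∞) : EReal)))
    (Or.inr (EReal.coe_ennreal_ne_bot _))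
    (Or.inl (by simp [EReal.add_eq_bot_iff, hE, hT]))).tendsto.comp (t4.prodMk_nhds t3)
  simp only [Ffun, hM]
  exact t5

/-- approximation of `ρ` by compactly supported probability measures with
convergence of `F_μ`. -/
theorem stmt7 (d : ℕ) (hd : 1 ≤ d) (α : ℝ) (hα : 0 < α)
    (ρ μ : Measure (Ed d)) (hρ : ρ ∈ P1 d) (hμ : μ ∈ P1 d) (hbμ : bary μ = 0) :
    ∃ ρs : ℕ → Measure (Ed d),
      (∀ n, IsProbabilityMeasure (ρs n)) ∧
      (∀ n, ∃ K : Set (Ed d), IsCompact K ∧ ρs n Kᶜ = 0) ∧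
      (∀ g : Ed d → ℝ, Continuous g → (∃ C : ℝ, ∀ x, |g x| ≤ C) →
        Filter.Tendsto (fun n => ∫ x, g x ∂(ρs n)) Filter.atTop (nhds (∫ x, g x ∂ρ))) ∧
      Filter.Tendsto (fun n => Ffun α μ (ρs n)) Filter.atTop (nhds (Ffun α μ ρ)) := by
  have := hρ.1
  have hcb : Monotone fun n : ℕ => Metric.closedBall (0 : Ed d) n := fun m n h =>
    Metric.closedBall_subset_closedBall (by exact_mod_cast h)
  have hcU : ⋃ n : ℕ, Metric.closedBall (0 : Ed d) n = Set.univ := Metric.iUnion_closedBall_nat 0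
  obtain ⟨N, hN⟩ : ∃ N : ℕ, 1 / 2 ≤ ρ.real (Metric.closedBall (0 : Ed d) N) := by
    have h := (ENNReal.tendsto_toReal ENNReal.one_ne_top).comp
      (tendsto_measure_of_iUnion_eq_univ (ρ := ρ) hcb hcU)
    exact (h.eventually_const_le (by norm_num)).exists
  set B : ℕ → Set (Ed d) := fun n => Metric.closedBall 0 ((n + N : ℕ) : ℝ)
  have hB : ∀ n, MeasurableSet (B n) := fun n => measurableSet_closedBall
  have hmono : Monotone B := fun m n h => hcb (Nat.add_le_add_right h N)
  have hU : ⋃ n, B n = Set.univ :=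
    Set.eq_univ_of_univ_subset (hcU ▸ Set.iUnion_mono fun n => hcb (Nat.le_add_right n N))
  have hhalf : ∀ n, 1 / 2 ≤ ρ.real (B n) := fun n =>
    hN.trans (measureReal_mono (hcb (Nat.le_add_left N n)))
  refine ⟨fun n => ρ[|B n], fun n => cond_isProbabilityMeasure fun h => ?_,
    fun n => ⟨B n, isCompact_closedBall _ _, ?_⟩, fun g hg ⟨C, hC⟩ => ?_,
    tendsto_Ffun_cond hα hρ hμ hbμ hB hmono hU hhalf fun n =>
      ⟨((n + N : ℕ) : ℝ), fun x hx => ?_⟩⟩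
  · have := hhalf n
    norm_num [Measure.real, h] at this
  · simp [cond_apply (hB n)]
  · exact tendsto_integral_cond hB hmono hU
      (Integrable.of_bound hg.aestronglyMeasurable C (ae_of_all _ hC))
  · exact mem_closedBall_zero_iff.1 hx
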